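/- Differential flatness of the unicycle: let p = (x, y) : ℝ → ℝ² be twice differentiable with x'(t)² + y'(t)² > 0 for all t. Define v(t) = √(x'(t)² + y'(t)²) and ω(t) = (x'(t)·y''(t) − x''(t)·y'(t)) / (x'(t)² + y'(t)²). Then there exists a differentiable heading function θ : ℝ → ℝ such that for all t: x'(t) = v(t)·cos θ(t), y'(t) = v(t)·sin θ(t), and θ'(t) = ω(t); that is, the unicycle dynamics ẋ = v cos θ, ẏ = v sin θ, θ̇ = ω is satisfied with control inputs (v, ω) recovered from the flat output (x, y) and its derivatives. -/

import Mathlib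

/-- A continuous logarithm of a differentiable curve is differentiable, with derivative the
logarithmic derivative of the curve. -/
theorem hasDerivAt_of_exp_eq {f F : ℝ → ℂ} {f' : ℂ} {t : ℝ} (hF : ContinuousAt F t)
    (hFf : ∀ s, Complex.exp (F s) = f s) (hf : HasDerivAt f f' t) :
    HasDerivAt F ((f t)⁻¹ * f') t := by
  have he : HasStrictDerivAt Complex.exp (f t) (F t) := hFf t ▸ Complex.hasStrictDerivAt_exp (F t)
  have hne : f t ≠ 0 := hFf t ▸ Complex.exp_ne_zero (F t)
  have hinv := (he.to_localInverse hne).hasDerivAt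
  rw [hFf t] at hinv
  refine (hinv.comp t hf).congr_of_eventuallyEq ?_
  have hleft := (he.hasStrictFDerivAt_equiv hne).eventually_left_inverse
  filter_upwards [hF.eventually hleft] with s hs
  simpa [hFf, HasStrictDerivAt.localInverse] using hs.symm

/-- A continuous nowhere vanishing curve in the complex plane has a continuous logarithm. -/
theorem exists_continuous_exp_eq {f : ℝ → ℂ} (hf : Continuous f) (hne : ∀ t, f t ≠ 0) :
    ∃ F : ℝ → ℂ, Continuous F ∧ ∀ t, Complex.exp (F t) = f t := by
  obtain ⟨F, ⟨-, hF⟩, -⟩ := Complex.isCoveringMapOn_exp.existsUnique_continuousMap_lifts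
    ⟨f, hf⟩ (a₀ := 0) (Complex.exp_log (hne 0)) hne
  exact ⟨F, F.continuous, congrFun hF⟩

/-- differential flatness of the unicycle: if `p = (x, y) : ℝ → ℝ²` is
twice differentiable with `x'(t)² + y'(t)² > 0` for all `t`, then with
`v(t) = √(x'(t)² + y'(t)²)` and `ω(t) = (x' y'' − x'' y') / (x'² + y'²)` there exists a
differentiable heading `θ : ℝ → ℝ` such that `x' = v cos θ`, `y' = v sin θ`, and
`θ' = ω`, i.e. the unicycle dynamics is satisfied with controls `(v, ω)` recovered from
the flat output `(x, y)`. -/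
theorem stmt_17 (x y : ℝ → ℝ)
    (hx : Differentiable ℝ x) (hx' : Differentiable ℝ (deriv x))
    (hy : Differentiable ℝ y) (hy' : Differentiable ℝ (deriv y))
    (hpos : ∀ t : ℝ, 0 < (deriv x t) ^ 2 + (deriv y t) ^ 2) :
    ∃ θ : ℝ → ℝ, Differentiable ℝ θ ∧ ∀ t : ℝ,
      deriv x t = Real.sqrt ((deriv x t) ^ 2 + (deriv y t) ^ 2) * Real.cos (θ t) ∧
      deriv y t = Real.sqrt ((deriv x t) ^ 2 + (deriv y t) ^ 2) * Real.sin (θ t) ∧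
      deriv θ t = (deriv x t * deriv (deriv y) t - deriv (deriv x) t * deriv y t) /
        ((deriv x t) ^ 2 + (deriv y t) ^ 2) := by
  set f : ℝ → ℂ := fun t ↦ ⟨deriv x t, deriv y t⟩ with hf_def
  have hf (t : ℝ) : HasDerivAt f ⟨deriv (deriv x) t, deriv (deriv y) t⟩ t := by
    have h := (hx' t).hasDerivAt.ofReal_comp.add
      ((hy' t).hasDerivAt.ofReal_comp.mul_const Complex.I)
    simp only [← Complex.mk_eq_add_mul_I] at h
    exact h.congr_of_eventuallyEq (.of_forall fun s ↦ Complex.mk_eq_add_mul_I _ _)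
  have hne (t : ℝ) : f t ≠ 0 := fun h ↦ by
    have hre : deriv x t = 0 := congrArg Complex.re h
    have him : deriv y t = 0 := congrArg Complex.im h
    simpa [hre, him] using hpos t
  obtain ⟨F, hFc, hF⟩ := exists_continuous_exp_eq
    (continuous_iff_continuousAt.2 fun t ↦ (hf t).continuousAt) hne
  have hθ (t : ℝ) := Complex.imCLM.hasFDerivAt.comp_hasDerivAt t
    (hasDerivAt_of_exp_eq hFc.continuousAt hF (hf t))
  have hnorm (t : ℝ) : Real.sqrt (deriv x t ^ 2 + deriv y t ^ 2) = Real.exp (F t).re := by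
    rw [← Complex.norm_exp, hF, Complex.norm_eq_sqrt_sq_add_sq]
  refine ⟨fun t ↦ (F t).im, fun t ↦ (hθ t).differentiableAt, fun t ↦ ⟨?_, ?_, ?_⟩⟩
  · rw [hnorm, ← Complex.exp_re, hF]
  · rw [hnorm, ← Complex.exp_im, hF]
  · refine (hθ t).deriv.trans ?_
    have := (hpos t).ne'
    simp only [hf_def, Complex.imCLM_apply, Complex.mul_im, Complex.inv_re, Complex.inv_im,
      Complex.normSq_mk]
    field_simp
    ring
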